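/- arXiv:1402.2261 — 8 statements merged into one kernel-verified Lean document; each statement's English description precedes it below -/
import Mathlib

section
/- If a 2g×2g real matrix V satisfies the Seifert condition V − Vᵀ = ω, then λ'_+(V) := Σ_{i=1}^{2g} Σ_{r=1}^{2g} σ_i · σ_r · V_{r,i} · V_{ī,r̄} equals 2 · λ'(V) − g. (This is the paper's Lemma: λ'_+(Σ) = 2λ' − g(Σ).) -/
open Matrix
open scoped BigOperators

/-- The conjugate index `ī` of an index `i` in `Fin (2*g)` (0-based): for paper indices
`1, …, 2g`, `ī = i+1` if `i` is odd and `ī = i−1` if `i` is even; in 0-based indexing this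
means adding 1 to even indices and subtracting 1 from odd ones. -/
def barIdx (g : ℕ) (i : Fin (2 * g)) : Fin (2 * g) :=
  if _h : i.val % 2 = 0 then ⟨i.val + 1, by have := i.isLt; omega⟩
  else ⟨i.val - 1, by have := i.isLt; omega⟩

/-- The sign `σ_i = (−1)^{i+1}` for paper indices `1, …, 2g`, i.e. `(−1)^i` in 0-based
indexing. -/
def sgnIdx (g : ℕ) (i : Fin (2 * g)) : ℝ := (-1 : ℝ) ^ (i : ℕ)

/-- The intersection form `ω` of a genus `g` surface in a symplectic basis:
`ω_{2a−1,2a} = 1`, `ω_{2a,2a−1} = −1` (paper indices `a = 1, …, g`), all other entries `0`. -/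
def omegaMat (g : ℕ) : Matrix (Fin (2 * g)) (Fin (2 * g)) ℝ :=
  Matrix.of fun i j =>
    if i.val + 1 = j.val ∧ i.val % 2 = 0 then 1
    else if j.val + 1 = i.val ∧ j.val % 2 = 0 then -1
    else 0

/-- `λ'(V) = Σ_{a,b=1}^{g} (V_{2a,2b}·V_{2a−1,2b−1} − V_{2a,2b−1}·V_{2a−1,2b})`
(paper indices), for a `2g × 2g` Seifert-type matrix `V`. -/
def lamPrime (g : ℕ) (V : Matrix (Fin (2 * g)) (Fin (2 * g)) ℝ) : ℝ :=
  ∑ a : Fin g, ∑ b : Fin g,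
    (V ⟨2 * a.val + 1, by have := a.isLt; omega⟩ ⟨2 * b.val + 1, by have := b.isLt; omega⟩ *
        V ⟨2 * a.val, by have := a.isLt; omega⟩ ⟨2 * b.val, by have := b.isLt; omega⟩ -
      V ⟨2 * a.val + 1, by have := a.isLt; omega⟩ ⟨2 * b.val, by have := b.isLt; omega⟩ *
        V ⟨2 * a.val, by have := a.isLt; omega⟩ ⟨2 * b.val + 1, by have := b.isLt; omega⟩)

theorem Fin.sum_univ_two_mul {M : Type*} [AddCommMonoid M] (g : ℕ) (f : Fin (2 * g) → M) :
    ∑ i, f i = ∑ a : Fin g, (f ⟨2 * a.val, by omega⟩ + f ⟨2 * a.val + 1, by omega⟩) := by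
  induction g with
  | zero => simp
  | succ n ih =>
    rw [Fin.sum_univ_castSucc (n := n)]
    change ∑ i : Fin (2 * n + 1 + 1), f i = _
    rw [Fin.sum_univ_castSucc, Fin.sum_univ_castSucc, ih, add_assoc]
    rfl

theorem barIdx_even (g a : ℕ) (h : 2 * a < 2 * g) :
    barIdx g ⟨2 * a, h⟩ = ⟨2 * a + 1, by omega⟩ := by
  simp [barIdx]

theorem barIdx_odd (g a : ℕ) (h : 2 * a + 1 < 2 * g) :
    barIdx g ⟨2 * a + 1, h⟩ = ⟨2 * a, by omega⟩ := by
  simp [barIdx, Nat.add_mod]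

theorem sgnIdx_even (g a : ℕ) (h : 2 * a < 2 * g) : sgnIdx g ⟨2 * a, h⟩ = 1 := by
  simp [sgnIdx]

theorem sgnIdx_odd (g a : ℕ) (h : 2 * a + 1 < 2 * g) : sgnIdx g ⟨2 * a + 1, h⟩ = -1 := by
  simp [sgnIdx, pow_succ]

/-- If `V − Vᵀ = ω` (Seifert condition), then
`λ'_+(V) = Σ_{i,r} σ_i · σ_r · V_{r,i} · V_{ī,r̄} = 2·λ'(V) − g`. -/
theorem lamPrimePlus_eq_two_lamPrime_sub_genus (g : ℕ) (hg : 1 ≤ g)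
    (V : Matrix (Fin (2 * g)) (Fin (2 * g)) ℝ) (hV : V - Vᵀ = omegaMat g) :
    ∑ i : Fin (2 * g), ∑ r : Fin (2 * g),
      sgnIdx g i * sgnIdx g r * V r i * V (barIdx g i) (barIdx g r)
      = 2 * lamPrime g V - (g : ℝ) := by
  have entry (i j) : V i j - V j i = omegaMat g i j := by rw [← hV]; rfl
  have card : (g : ℝ) = ∑ a : Fin g, ∑ b : Fin g, if a = b then (1 : ℝ) else 0 := by simp
  rw [lamPrime, card, Fin.sum_univ_two_mul, Finset.mul_sum, ← Finset.sum_sub_distrib]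
  refine Finset.sum_congr rfl fun a _ => ?_
  rw [Fin.sum_univ_two_mul, Fin.sum_univ_two_mul, ← Finset.sum_add_distrib, Finset.mul_sum,
    ← Finset.sum_sub_distrib]
  refine Finset.sum_congr rfl fun b _ => ?_
  simp only [barIdx_even, barIdx_odd, sgnIdx_even, sgnIdx_odd]
  have h00 := entry ⟨2 * b.val, by omega⟩ ⟨2 * a.val, by omega⟩
  have h11 := entry ⟨2 * b.val + 1, by omega⟩ ⟨2 * a.val + 1, by omega⟩
  have h01 := entry ⟨2 * b.val, by omega⟩ ⟨2 * a.val + 1, by omega⟩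
  have h10 := entry ⟨2 * b.val + 1, by omega⟩ ⟨2 * a.val, by omega⟩
  simp only [omegaMat, Matrix.of_apply] at h00 h11 h01 h10
  rw [if_neg (by omega), if_neg (by omega), sub_eq_zero] at h00 h11
  rw [h00, h11]
  by_cases hab : a = b
  · subst hab
    rw [if_pos (by omega)] at h01
    rw [if_pos rfl]
    linear_combination (-1 - V ⟨2 * a.val, by omega⟩ ⟨2 * a.val + 1, by omega⟩ +
      V ⟨2 * a.val + 1, by omega⟩ ⟨2 * a.val, by omega⟩) * h01
  · have hne : a.val ≠ b.val := fun h => hab (Fin.ext h)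
    rw [if_neg (by omega), if_neg (by omega), sub_eq_zero] at h01 h10
    rw [if_neg hab, h01, h10]
    ring
end

section
/- If a 2g×2g real matrix V satisfies the Seifert condition V − Vᵀ = ω, then Σ_{i=1}^{2g} Σ_{r=1}^{2g} σ_i · σ_r · ( V_{i,ī}·V_{r,r̄} − V_{i,r̄}·V_{r,ī} ) = g² + 2 · λ'(V) − g. (This is the identity 2A = g² + λ'_+ established in the proof of the paper's Lemma relating λ' to the Alexander polynomial.) -/
open Matrix
open scoped BigOperators

/-- The even index `2a` in `Fin (2 * g)`. -/
def evenIdx {g : ℕ} (a : Fin g) : Fin (2 * g) := ⟨2 * a.val, by have := a.isLt; omega⟩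

/-- The odd index `2a + 1` in `Fin (2 * g)`. -/
def oddIdx {g : ℕ} (a : Fin g) : Fin (2 * g) := ⟨2 * a.val + 1, by have := a.isLt; omega⟩

theorem sum_fin_two_mul {M : Type*} [AddCommMonoid M] {g : ℕ} (f : Fin (2 * g) → M) :
    ∑ i, f i = ∑ a : Fin g, (f (evenIdx a) + f (oddIdx a)) := by
  rw [← (finProdFinEquiv.trans (finCongr (Nat.mul_comm g 2))).sum_comp, Fintype.sum_prod_type]
  refine Finset.sum_congr rfl fun a _ => ?_
  rw [Fin.sum_univ_two]
  congr 2 <;> ext <;> simp [evenIdx, oddIdx, add_comm]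

theorem barIdx_evenIdx {g : ℕ} (a : Fin g) : barIdx g (evenIdx a) = oddIdx a := by
  simp [barIdx, evenIdx, oddIdx]

theorem barIdx_oddIdx {g : ℕ} (a : Fin g) : barIdx g (oddIdx a) = evenIdx a := by
  simp [barIdx, evenIdx, oddIdx, Nat.add_mod]

theorem sgnIdx_evenIdx {g : ℕ} (a : Fin g) : sgnIdx g (evenIdx a) = 1 := by
  simp [sgnIdx, evenIdx]

theorem sgnIdx_oddIdx {g : ℕ} (a : Fin g) : sgnIdx g (oddIdx a) = -1 := by
  simp [sgnIdx, oddIdx, pow_succ]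

theorem omegaMat_evenIdx_evenIdx {g : ℕ} (a b : Fin g) :
    omegaMat g (evenIdx a) (evenIdx b) = 0 := by
  simp only [omegaMat, evenIdx, Matrix.of_apply]
  rw [if_neg (by omega), if_neg (by omega)]

theorem omegaMat_oddIdx_oddIdx {g : ℕ} (a b : Fin g) :
    omegaMat g (oddIdx a) (oddIdx b) = 0 := by
  simp only [omegaMat, oddIdx, Matrix.of_apply]
  rw [if_neg (by omega), if_neg (by omega)]

theorem omegaMat_evenIdx_oddIdx {g : ℕ} (a b : Fin g) :
    omegaMat g (evenIdx a) (oddIdx b) = if a = b then 1 else 0 := by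
  simp only [omegaMat, evenIdx, oddIdx, Matrix.of_apply, Fin.ext_iff]
  split_ifs <;> first | rfl | omega

/-- If `V − Vᵀ = ω` (Seifert condition), then
`Σ_{i,r} σ_i · σ_r · (V_{i,ī}·V_{r,r̄} − V_{i,r̄}·V_{r,ī}) = g² + 2·λ'(V) − g`. -/
theorem two_A_eq (g : ℕ) (hg : 1 ≤ g)
    (V : Matrix (Fin (2 * g)) (Fin (2 * g)) ℝ) (hV : V - Vᵀ = omegaMat g) :
    ∑ i : Fin (2 * g), ∑ r : Fin (2 * g),
      sgnIdx g i * sgnIdx g r *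
        (V i (barIdx g i) * V r (barIdx g r) - V i (barIdx g r) * V r (barIdx g i))
      = (g : ℝ) ^ 2 + 2 * lamPrime g V - (g : ℝ) := by
  have sub_swap (i j) : V i j - V j i = omegaMat g i j := by
    rw [← hV, Matrix.sub_apply, Matrix.transpose_apply]
  have diag (a : Fin g) : V (evenIdx a) (oddIdx a) - V (oddIdx a) (evenIdx a) = 1 := by
    rw [sub_swap, omegaMat_evenIdx_oddIdx, if_pos rfl]
  have lam : lamPrime g V = ∑ a : Fin g, ∑ b : Fin g,
      (V (oddIdx a) (oddIdx b) * V (evenIdx a) (evenIdx b) -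
        V (oddIdx a) (evenIdx b) * V (evenIdx a) (oddIdx b)) := rfl
  have block (a b : Fin g) :
      (V (evenIdx a) (oddIdx a) - V (oddIdx a) (evenIdx a)) *
          (V (evenIdx b) (oddIdx b) - V (oddIdx b) (evenIdx b)) -
        (V (evenIdx a) (oddIdx b) * V (evenIdx b) (oddIdx a) -
          V (evenIdx a) (evenIdx b) * V (oddIdx b) (oddIdx a) -
          V (oddIdx a) (oddIdx b) * V (evenIdx b) (evenIdx a) +
          V (oddIdx a) (evenIdx b) * V (oddIdx b) (evenIdx a)) =
      1 + 2 * (V (oddIdx a) (oddIdx b) * V (evenIdx a) (evenIdx b) -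
        V (oddIdx a) (evenIdx b) * V (evenIdx a) (oddIdx b)) - if a = b then 1 else 0 := by
    have ee := sub_swap (evenIdx b) (evenIdx a)
    have oo := sub_swap (oddIdx b) (oddIdx a)
    have eo := sub_swap (evenIdx b) (oddIdx a)
    have oe := sub_swap (evenIdx a) (oddIdx b)
    rw [omegaMat_evenIdx_evenIdx, sub_eq_zero] at ee
    rw [omegaMat_oddIdx_oddIdx, sub_eq_zero] at oo
    rw [omegaMat_evenIdx_oddIdx, sub_eq_iff_eq_add] at eo
    rw [omegaMat_evenIdx_oddIdx, sub_eq_iff_eq_add', ← sub_eq_iff_eq_add] at oe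
    rw [diag, diag, ee, oo, eo, ← oe]
    rcases eq_or_ne a b with rfl | hab
    · simp only [if_true]
      linear_combination -diag a
    · simp only [if_neg hab, if_neg hab.symm]
      ring
  calc
    _ = ∑ a : Fin g, ∑ b : Fin g,
        (1 + 2 * (V (oddIdx a) (oddIdx b) * V (evenIdx a) (evenIdx b) -
          V (oddIdx a) (evenIdx b) * V (evenIdx a) (oddIdx b)) - if a = b then 1 else 0) := by
      simp only [sum_fin_two_mul, ← Finset.sum_add_distrib]
      refine Finset.sum_congr rfl fun a _ => Finset.sum_congr rfl fun b _ => ?_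
      rw [← block]
      simp only [barIdx_evenIdx, barIdx_oddIdx, sgnIdx_evenIdx, sgnIdx_oddIdx]
      ring
    _ = _ := by
      simp only [Finset.sum_sub_distrib, Finset.sum_add_distrib, ← Finset.mul_sum, lam]
      simp [sq]
end

section
/- Let V be a 2g×2g real matrix satisfying the Seifert condition V − Vᵀ = ω, and let P(X) := det(X·V − Vᵀ) be the polynomial in ℝ[X] given as the determinant of the 2g×2g matrix of polynomials whose (r,s)-entry is V_{r,s}·X − V_{s,r}. Then P evaluated at 1 equals 1, and the derivative of P evaluated at 1 equals g. (These are the zeroth- and first-order terms of the Taylor expansion of the Alexander determinant at t = 1 established in the paper.) -/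
open Matrix
open scoped BigOperators

/-- The Alexander determinant `P(X) = det(X·V − Vᵀ)`, i.e. the determinant of the
`2g × 2g` matrix of polynomials whose `(r,s)`-entry is `V_{r,s}·X − V_{s,r}`. -/
noncomputable def alexDetPoly (g : ℕ) (V : Matrix (Fin (2 * g)) (Fin (2 * g)) ℝ) :
    Polynomial ℝ :=
  Matrix.det (Matrix.of fun r s => Polynomial.C (V r s) * Polynomial.X - Polynomial.C (V s r))

/-- The determinant of the standard symplectic form `ω` is `1`. -/
lemma det_omegaMat (g : ℕ) : (omegaMat g).det = 1 := by
  let e : Fin 2 × Fin g ≃ Fin (2 * g) :=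
    ((Equiv.prodComm _ _).trans finProdFinEquiv).trans (finCongr (mul_comm g 2))
  have h : (omegaMat g).submatrix e e =
      blockDiagonal fun _ : Fin g => !![(0 : ℝ), 1; -1, 0] := by
    ext ⟨i, a⟩ ⟨j, b⟩
    have he (k : Fin 2) (c : Fin g) : (e (k, c)).val = k.val + 2 * c.val := rfl
    simp only [submatrix_apply, omegaMat, of_apply, blockDiagonal_apply, he, Fin.ext_iff]
    fin_cases i <;> fin_cases j <;> simp <;> grind
  rw [← det_submatrix_equiv_self e, h, det_blockDiagonal]
  simp [det_fin_two_of]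

lemma eval_alexDetPoly (g : ℕ) (V : Matrix (Fin (2 * g)) (Fin (2 * g)) ℝ) (t : ℝ) :
    (alexDetPoly g V).eval t = (t • V - Vᵀ).det := by
  rw [alexDetPoly, ← Polynomial.coe_evalRingHom, RingHom.map_det]
  congr 1
  ext r s
  simp only [RingHom.mapMatrix_apply, map_apply, of_apply, Polynomial.coe_evalRingHom,
    Polynomial.eval_sub, Polynomial.eval_mul, Polynomial.eval_C, Polynomial.eval_X, Matrix.sub_apply,
    Matrix.smul_apply, transpose_apply, smul_eq_mul, mul_comm t]

/-- The Alexander determinant is palindromic of degree `2g`. -/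
lemma eval_alexDetPoly_inv (g : ℕ) (V : Matrix (Fin (2 * g)) (Fin (2 * g)) ℝ) {t : ℝ}
    (ht : t ≠ 0) :
    t ^ (2 * g) * (alexDetPoly g V).eval t⁻¹ = (alexDetPoly g V).eval t := by
  have h : t • (t⁻¹ • V - Vᵀ) = -(t • V - Vᵀ)ᵀ := by
    rw [smul_sub, smul_inv_smul₀ ht, transpose_sub, transpose_smul, transpose_transpose, neg_sub]
  have hdet := congrArg det h
  rw [det_smul, det_neg, det_transpose, Fintype.card_fin, pow_mul (-1 : ℝ)] at hdet
  simpa [eval_alexDetPoly] using hdet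

/-- If `V − Vᵀ = ω` (Seifert condition) and `P(X) = det(X·V − Vᵀ)`, then `P(1) = 1`
and `P'(1) = g`. -/
theorem alexDetPoly_eval_one_and_deriv (g : ℕ) (hg : 1 ≤ g)
    (V : Matrix (Fin (2 * g)) (Fin (2 * g)) ℝ) (hV : V - Vᵀ = omegaMat g) :
    (alexDetPoly g V).eval 1 = 1 ∧
      (Polynomial.derivative (alexDetPoly g V)).eval 1 = (g : ℝ) := by
  have h1 : (alexDetPoly g V).eval 1 = 1 := by
    rw [eval_alexDetPoly, one_smul, hV, det_omegaMat]
  refine ⟨h1, ?_⟩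
  set P := alexDetPoly g V
  have hinv : HasDerivAt (fun t : ℝ => P.eval t⁻¹) (P.derivative.eval 1 * -1) 1 := by
    have h := hasDerivAt_inv (one_ne_zero : (1 : ℝ) ≠ 0)
    have hp : HasDerivAt (fun t => P.eval t) (P.derivative.eval 1) (1 : ℝ)⁻¹ := by
      simpa using P.hasDerivAt 1
    simpa [Function.comp_def] using hp.comp 1 h
  have hprod := (hasDerivAt_pow (2 * g) (1 : ℝ)).mul hinv
  have hev : (fun t : ℝ => P.eval t) =ᶠ[nhds 1] fun t => t ^ (2 * g) * P.eval t⁻¹ := by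
    filter_upwards [eventually_ne_nhds (one_ne_zero : (1 : ℝ) ≠ 0)] with t ht
    exact (eval_alexDetPoly_inv g V ht).symm
  have h := (hprod.congr_of_eventuallyEq hev).unique (P.hasDerivAt 1)
  simp [h1] at h
  linarith
end

section
/- Let V be a 2g×2g real matrix satisfying the Seifert condition V − Vᵀ = ω, and let P(X) := det(X·V − Vᵀ) ∈ ℝ[X]. Then the second derivative of P evaluated at 1 equals g² − g + 2 · λ'(V). (This is the second-order term of the Taylor expansion of the Alexander determinant at t = 1 established in the paper.) -/
open Matrix
open scoped BigOperators

/-- Twice the quadratic coefficient of `det (1 + X • M)` is `(tr M)² - tr (M²)`. -/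
lemma two_mul_coeff_det_one_add_X_smul_two {R n : Type*} [CommRing R] [Fintype n] [DecidableEq n]
    (M : Matrix n n R) :
    2 * (det (1 + (Polynomial.X : Polynomial R) • M.map Polynomial.C)).coeff 2
      = M.trace ^ 2 - (M * M).trace := by
  set F : Polynomial R := det (1 + (Polynomial.X : Polynomial R) • M.map Polynomial.C) with hF
  set G : Polynomial R :=
    det (1 + (Polynomial.X : Polynomial R) • (-(M * M)).map Polynomial.C) with hG
  have hneg : F.comp (-Polynomial.X)
      = det (1 - (Polynomial.X : Polynomial R) • M.map Polynomial.C) := by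
    rw [← Polynomial.coe_compRingHom_apply, hF, RingHom.map_det]
    congr 1
    ext1 i j
    by_cases h : i = j <;> simp [h, sub_eq_add_neg]
  have hsq : Polynomial.expand R 2 G
      = det (1 - ((Polynomial.X : Polynomial R) • M.map Polynomial.C) *
          ((Polynomial.X : Polynomial R) • M.map Polynomial.C)) := by
    rw [hG, AlgHom.map_det]
    congr 1
    rw [Matrix.smul_mul, Matrix.mul_smul, ← Matrix.map_mul]
    ext1 i j
    by_cases h : i = j <;> simp [h, -Matrix.map_mul] <;> ring
  have hprod : F * F.comp (-Polynomial.X) = Polynomial.expand R 2 G := by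
    rw [hneg, hsq, hF, ← det_mul]
    congr 1
    rw [mul_sub, mul_one, add_mul, one_mul]
    abel
  have hcoeff := congrArg (fun p : Polynomial R => p.coeff 2) hprod
  have hcomp (k : ℕ) : (F.comp (-Polynomial.X)).coeff k = F.coeff k * (-1) ^ k := by
    rw [← Polynomial.comp_C_mul_X_coeff, map_neg, map_one, neg_one_mul]
  have hF0 : F.coeff 0 = 1 := by
    rw [hF, Polynomial.coeff_zero_eq_eval_zero, eval_det_add_X_smul, det_one, Polynomial.eval_one]
  have hG1 : (Polynomial.expand R 2 G).coeff 2 = -(M * M).trace := by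
    rw [Polynomial.coeff_expand two_pos, if_pos dvd_rfl, Nat.div_self two_pos, hG,
      coeff_det_one_add_X_smul_one, trace_neg]
  have hF1 : F.coeff 1 = M.trace := coeff_det_one_add_X_smul_one M
  rw [hG1, Polynomial.coeff_mul] at hcoeff
  simp [Finset.Nat.antidiagonal_succ, hcomp, hF0, hF1] at hcoeff
  linear_combination hcoeff

/-- The bijection `(k, a) ↦ 2a + k`. -/
def blockEquiv (g : ℕ) : Fin 2 × Fin g ≃ Fin (2 * g) :=
  (Equiv.prodComm _ _).trans (finProdFinEquiv.trans (finCongr (mul_comm g 2)))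

lemma blockEquiv_val (g : ℕ) (k : Fin 2) (a : Fin g) :
    (blockEquiv g (k, a) : ℕ) = 2 * a + k := by
  simp [blockEquiv, add_comm]

lemma omegaMat_submatrix_blockEquiv (g : ℕ) :
    (omegaMat g).submatrix (blockEquiv g) (blockEquiv g)
      = blockDiagonal fun _ : Fin g => !![(0 : ℝ), 1; -1, 0] := by
  ext ⟨k, a⟩ ⟨l, b⟩
  simp only [submatrix_apply, omegaMat, of_apply, blockEquiv_val, blockDiagonal_apply, Fin.ext_iff]
  fin_cases k <;> fin_cases l <;> simp <;> split_ifs <;> first | rfl | omega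

lemma lamPrime_eq_sum_blockEquiv (g : ℕ) (V : Matrix (Fin (2 * g)) (Fin (2 * g)) ℝ) :
    lamPrime g V = ∑ a : Fin g, ∑ b : Fin g,
      (V (blockEquiv g (1, a)) (blockEquiv g (1, b)) * V (blockEquiv g (0, a)) (blockEquiv g (0, b))
        - V (blockEquiv g (1, a)) (blockEquiv g (0, b))
          * V (blockEquiv g (0, a)) (blockEquiv g (1, b))) := by
  have h0 (a : Fin g) : blockEquiv g (0, a) = ⟨2 * a, by omega⟩ :=
    Fin.ext (by simp [blockEquiv_val])
  have h1 (a : Fin g) : blockEquiv g (1, a) = ⟨2 * a + 1, by omega⟩ :=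
    Fin.ext (by simp [blockEquiv_val])
  simp only [h0, h1, lamPrime]

/-- If `A - Aᵀ = W` is invertible with inverse `-W` and determinant `1`, then `det (X • A - Aᵀ)` is
`det (1 + Y • (-W * A))` at `Y = X - 1`. -/
lemma det_X_smul_sub_transpose {R n : Type*} [CommRing R] [Fintype n] [DecidableEq n]
    {A W : Matrix n n R} (hA : A - Aᵀ = W) (hW : W * W = -1) (hdet : W.det = 1) :
    det (Matrix.of fun r s =>
        Polynomial.C (A r s) * Polynomial.X - Polynomial.C (A s r) : Matrix n n (Polynomial R))
      = (det (1 + (Polynomial.X : Polynomial R) • (-(W * A)).map Polynomial.C)).comp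
          (Polynomial.X - 1) := by
  have hfac : (Matrix.of fun r s => Polynomial.C (A r s) * Polynomial.X - Polynomial.C (A s r))
      = W.map Polynomial.C *
        (1 + ((Polynomial.X : Polynomial R) - 1) • (-(W * A)).map Polynomial.C) := by
    rw [mul_add, mul_one, Matrix.mul_smul, ← Matrix.map_mul, mul_neg, ← mul_assoc, hW, neg_one_mul,
      neg_neg, ← hA]
    ext1 i j
    simp
    ring
  have hdetC : (W.map (Polynomial.C : R →+* Polynomial R)).det = 1 := by
    rw [← RingHom.mapMatrix_apply, ← RingHom.map_det, hdet, map_one]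
  rw [hfac, det_mul, hdetC, one_mul, ← Polynomial.coe_compRingHom_apply, RingHom.map_det]
  congr 1
  ext1 i j
  by_cases h : i = j <;> simp [h] <;> ring

lemma eval_one_derivative_derivative_comp_X_sub_one {R : Type*} [CommRing R] (F : Polynomial R) :
    (Polynomial.derivative (Polynomial.derivative (F.comp (Polynomial.X - 1)))).eval 1
      = 2 * F.coeff 2 := by
  have h : ((Polynomial.derivative (Polynomial.derivative F))).coeff 0 = 2 * F.coeff 2 := by
    simp [Polynomial.coeff_derivative, one_add_one_eq_two, mul_comm]
  simp [Polynomial.derivative_comp, ← h, Polynomial.coeff_zero_eq_eval_zero]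

/-- If `V − Vᵀ = ω` (Seifert condition) and `P(X) = det(X·V − Vᵀ)`, then
`P''(1) = g² − g + 2·λ'(V)`. -/
theorem alexDetPoly_second_deriv (g : ℕ) (hg : 1 ≤ g)
    (V : Matrix (Fin (2 * g)) (Fin (2 * g)) ℝ) (hV : V - Vᵀ = omegaMat g) :
    (Polynomial.derivative (Polynomial.derivative (alexDetPoly g V))).eval 1
      = (g : ℝ) ^ 2 - (g : ℝ) + 2 * lamPrime g V := by
  set e := blockEquiv g with he
  set A := V.submatrix e e with hAdef
  set W : Matrix (Fin 2 × Fin g) (Fin 2 × Fin g) ℝ :=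
    blockDiagonal fun _ : Fin g => !![(0 : ℝ), 1; -1, 0] with hWdef
  have hA : A - Aᵀ = W := by
    rw [hWdef, ← omegaMat_submatrix_blockEquiv, ← hV]
    rfl
  have hW : W * W = -1 := by
    rw [hWdef, ← blockDiagonal_mul, ← blockDiagonal_one, ← blockDiagonal_neg]
    congr 1
    ext _ i j
    fin_cases i <;> fin_cases j <;> simp
  have hdet : W.det = 1 := by simp [hWdef, det_blockDiagonal, det_fin_two]
  have hP : alexDetPoly g V
      = (det (1 + (Polynomial.X : Polynomial ℝ) • (-(W * A)).map Polynomial.C)).comp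
          (Polynomial.X - 1) := by
    rw [← det_X_smul_sub_transpose hA hW hdet, alexDetPoly, ← det_submatrix_equiv_self e]
    rfl
  rw [hP, eval_one_derivative_derivative_comp_X_sub_one, two_mul_coeff_det_one_add_X_smul_two]
  have hWA0 (a : Fin g) (x) : (W * A) (0, a) x = A (1, a) x := by
    simp [hWdef, Matrix.mul_apply, Fintype.sum_prod_type, blockDiagonal_apply]
  have hWA1 (a : Fin g) (x) : (W * A) (1, a) x = -A (0, a) x := by
    simp [hWdef, Matrix.mul_apply, Fintype.sum_prod_type, blockDiagonal_apply]
  have hswap (i j) : A j i = A i j - W i j := by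
    rw [← hA]
    simp
  have htr : (-(W * A)).trace = g := by
    simp only [trace, diag_apply, Matrix.neg_apply, Fintype.sum_prod_type_right, Fin.sum_univ_two,
      hWA0, hWA1]
    have h (a : Fin g) : -A (1, a) (0, a) + - -A (0, a) (1, a) = 1 := by
      rw [hswap (0, a) (1, a)]
      simp [hWdef]
    rw [Finset.sum_congr rfl fun a _ => h a]
    simp
  have htr2 : (-(W * A) * -(W * A)).trace = g - 2 * lamPrime g V := by
    have h (a b : Fin g) :
        A (1, a) (0, b) * A (1, b) (0, a) - A (1, a) (1, b) * A (0, b) (0, a)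
          + (A (0, a) (1, b) * A (0, b) (1, a) - A (0, a) (0, b) * A (1, b) (1, a))
        = (if a = b then 1 else 0)
          - 2 * (A (1, a) (1, b) * A (0, a) (0, b) - A (1, a) (0, b) * A (0, a) (1, b)) := by
      have hswap' := hswap (0, a) (1, a)
      rw [hswap (0, a) (1, b), hswap (0, a) (0, b), hswap (1, a) (0, b), hswap (1, a) (1, b)]
      by_cases hab : a = b
      · subst hab
        simp [hWdef] at hswap' ⊢
        linear_combination -hswap'
      · simp [hWdef, blockDiagonal_apply, hab]
        ring
    rw [neg_mul_neg, lamPrime_eq_sum_blockEquiv]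
    calc ((W * A) * (W * A)).trace
        = ∑ a, ∑ b, (A (1, a) (0, b) * A (1, b) (0, a) - A (1, a) (1, b) * A (0, b) (0, a)
          + (A (0, a) (1, b) * A (0, b) (1, a) - A (0, a) (0, b) * A (1, b) (1, a))) := by
          simp only [trace, diag_apply, Matrix.mul_apply (M := W * A), Fintype.sum_prod_type_right,
            Fin.sum_univ_two, hWA0, hWA1, ← Finset.sum_add_distrib]
          refine Finset.sum_congr rfl fun a _ => Finset.sum_congr rfl fun b _ => ?_
          ring
      _ = _ := by
          simp only [h, Finset.sum_sub_distrib, ← Finset.mul_sum]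
          simp [hAdef, he]
  rw [htr, htr2]
  ring
end

section
/- Let V be a 2g×2g real matrix satisfying the Seifert condition V − Vᵀ = ω, and define the real function Δ(t) := t^{−g} · det(t·V − Vᵀ) for t in a neighbourhood of 1 (the Alexander polynomial of a knot with Seifert matrix V, evaluated at t). Then one half of the second derivative of Δ at 1 equals λ'(V): (1/2) · Δ''(1) = λ'(V). (This is the paper's Lemma identifying λ' with ½ Δ_K''(1).) -/
open Matrix
open scoped BigOperators

/-- The Alexander polynomial function `Δ(t) = t^{−g} · det(t·V − Vᵀ)` of a knot with
Seifert matrix `V`, as a real function of `t`. -/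
noncomputable def alexFun (g : ℕ) (V : Matrix (Fin (2 * g)) (Fin (2 * g)) ℝ) : ℝ → ℝ :=
  fun t => t ^ (-(g : ℤ)) * Matrix.det (t • V - Vᵀ)

open scoped Kronecker
open Polynomial

/-- The quadratic coefficient of `det (1 + s M)` is `(tr(M)² - tr(M²)) / 2`. -/
lemma exists_det_one_add_smul_eq {n : Type*} [Fintype n] [DecidableEq n] (M : Matrix n n ℝ) :
    ∃ Q : ℝ[X], (∀ s : ℝ, (1 + s • M).det = 1 + M.trace * s + Q.eval s * s ^ 2) ∧
      2 * Q.eval 0 = M.trace ^ 2 - (M * M).trace := by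
  refine ⟨_, fun s => Matrix.det_one_add_smul s M, ?_⟩
  set Q : ℝ[X] := (det (1 + (X : ℝ[X]) • M.map C)).divX.divX
  have hM : ∀ s : ℝ, (1 + s • M).det = 1 + M.trace * s + Q.eval s * s ^ 2 :=
    fun s => Matrix.det_one_add_smul s M
  obtain ⟨R, hR⟩ : ∃ R : ℝ[X], ∀ s : ℝ,
      (1 + s • (M * M)).det = 1 + (M * M).trace * s + R.eval s * s ^ 2 :=
    ⟨_, fun s => Matrix.det_one_add_smul s _⟩
  have hprod : ∀ s : ℝ, (1 + s • M).det * (1 + (-s) • M).det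
      = (1 + (-s ^ 2) • (M * M)).det := by
    intro s
    rw [← det_mul]
    congr 1
    simp only [add_mul, mul_add, one_mul, mul_one, neg_smul, mul_neg, smul_mul_smul_comm, sq]
    abel
  have key : (fun s : ℝ => Q.eval s + Q.eval (-s) - M.trace ^ 2
        + M.trace * s * (Q.eval (-s) - Q.eval s) + s ^ 2 * (Q.eval s * Q.eval (-s)))
      = fun s => -(M * M).trace + s ^ 2 * R.eval (-s ^ 2) := by
    refine Continuous.ext_on (dense_compl_singleton (0 : ℝ)) (by fun_prop) (by fun_prop) ?_
    intro s hs
    have hs : s ≠ 0 := hs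
    have h := hprod s
    rw [hM, hM, hR] at h
    apply mul_left_cancel₀ (pow_ne_zero 2 hs)
    linear_combination h
  have h0 := congrFun key 0
  simp at h0
  linarith

lemma deriv_deriv_zpow_mul_eval (g : ℕ) (P : ℝ[X]) :
    deriv (deriv fun t : ℝ => t ^ (-(g : ℤ)) * P.eval t) 1
      = g * (g + 1) * P.eval 1 - 2 * g * P.derivative.eval 1
        + P.derivative.derivative.eval 1 := by
  have hd : ∀ (P : ℝ[X]) (m : ℤ) (t : ℝ), t ≠ 0 → HasDerivAt (fun t : ℝ => t ^ m * P.eval t)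
      (m * t ^ (m - 1) * P.eval t + t ^ m * P.derivative.eval t) t :=
    fun P m t ht => (hasDerivAt_zpow m t (Or.inl ht)).mul (P.hasDerivAt t)
  have h1 : deriv (fun t : ℝ => t ^ (-(g : ℤ)) * P.eval t) =ᶠ[nhds 1]
      fun t => (-(g : ℤ) : ℤ) * (t ^ (-(g : ℤ) - 1) * P.eval t)
        + t ^ (-(g : ℤ)) * P.derivative.eval t := by
    filter_upwards [isOpen_ne.mem_nhds (one_ne_zero : (1 : ℝ) ≠ 0)] with t ht
    rw [(hd P _ t ht).deriv]
    ring
  have h2 := ((hd P (-(g : ℤ) - 1) 1 one_ne_zero).const_mul ((-(g : ℤ) : ℤ) : ℝ)).fun_add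
    (hd P.derivative (-(g : ℤ)) 1 one_ne_zero)
  rw [h1.deriv_eq, h2.deriv]
  simp
  ring

/-- Indices of a symplectic basis as pairs (handle, position in the handle). -/
def handleEquiv (g : ℕ) : Fin g × Fin 2 ≃ Fin (2 * g) :=
  finProdFinEquiv.trans (finCongr (mul_comm g 2))

lemma handleEquiv_val (g : ℕ) (x : Fin g × Fin 2) :
    (handleEquiv g x : ℕ) = 2 * x.1 + x.2 := by
  simp [handleEquiv, finProdFinEquiv, add_comm]

/-- The standard symplectic form on pairs of indices. -/
def sympMat (ι : Type*) [DecidableEq ι] : Matrix (ι × Fin 2) (ι × Fin 2) ℝ :=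
  (1 : Matrix ι ι ℝ) ⊗ₖ !![0, 1; -1, 0]

lemma omegaMat_submatrix (g : ℕ) :
    (omegaMat g).submatrix (handleEquiv g) (handleEquiv g) = sympMat (Fin g) := by
  ext ⟨a, k⟩ ⟨b, l⟩
  simp only [submatrix_apply, omegaMat, of_apply, handleEquiv_val, sympMat, kronecker_apply,
    one_apply, Fin.ext_iff]
  fin_cases k <;> fin_cases l <;> simp <;> grind

lemma lamPrime_eq_sum (g : ℕ) (V : Matrix (Fin (2 * g)) (Fin (2 * g)) ℝ) :
    lamPrime g V = ∑ a, ∑ b,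
      (V.submatrix (handleEquiv g) (handleEquiv g) (a, 1) (b, 1)
        * V.submatrix (handleEquiv g) (handleEquiv g) (a, 0) (b, 0)
      - V.submatrix (handleEquiv g) (handleEquiv g) (a, 1) (b, 0)
        * V.submatrix (handleEquiv g) (handleEquiv g) (a, 0) (b, 1)) := by
  have h0 : ∀ a : Fin g, handleEquiv g (a, 0) = ⟨2 * a.val, by omega⟩ :=
    fun a => Fin.ext (by simp [handleEquiv_val])
  have h1 : ∀ a : Fin g, handleEquiv g (a, 1) = ⟨2 * a.val + 1, by omega⟩ :=
    fun a => Fin.ext (by simp [handleEquiv_val])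
  simp only [lamPrime, submatrix_apply, h0, h1]

section Symplectic

variable {ι : Type*} [Fintype ι] [DecidableEq ι]

lemma det_sympMat : (sympMat ι).det = 1 := by
  simp [sympMat, det_kronecker, det_fin_two]

lemma sympMat_mul_self : sympMat ι * sympMat ι = -1 := by
  rw [sympMat, ← mul_kronecker_mul]
  have : (!![0, 1; -1, 0] : Matrix (Fin 2) (Fin 2) ℝ) * !![0, 1; -1, 0] = -1 := by
    ext i j; fin_cases i <;> fin_cases j <;> simp
  rw [this, one_mul]
  ext ⟨a, k⟩ ⟨b, l⟩
  by_cases hab : a = b <;> simp [one_apply, hab]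

lemma sympMat_mul_apply_zero (W : Matrix (ι × Fin 2) (ι × Fin 2) ℝ) (a : ι) (y : ι × Fin 2) :
    (sympMat ι * W) (a, 0) y = W (a, 1) y := by
  simp [mul_apply, Fintype.sum_prod_type, sympMat, one_apply]

lemma sympMat_mul_apply_one (W : Matrix (ι × Fin 2) (ι × Fin 2) ℝ) (a : ι) (y : ι × Fin 2) :
    (sympMat ι * W) (a, 1) y = -W (a, 0) y := by
  simp [mul_apply, Fintype.sum_prod_type, sympMat, one_apply]

variable {W : Matrix (ι × Fin 2) (ι × Fin 2) ℝ}

lemma sub_swap_of_sub_transpose_eq (hW : W - Wᵀ = sympMat ι) (a : ι) :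
    W (a, 1) (a, 0) - W (a, 0) (a, 1) = -1 := by
  simpa [sympMat] using congrFun (congrFun hW (a, 1)) (a, 0)

lemma trace_sympMat_mul (hW : W - Wᵀ = sympMat ι) :
    (sympMat ι * W).trace = -Fintype.card ι := by
  simp only [trace, diag, Fintype.sum_prod_type, Fin.sum_univ_two, sympMat_mul_apply_zero,
    sympMat_mul_apply_one, ← sub_eq_add_neg, sub_swap_of_sub_transpose_eq hW]
  simp

lemma trace_sympMat_mul_sq (hW : W - Wᵀ = sympMat ι) :
    (sympMat ι * W * (sympMat ι * W)).trace = Fintype.card ι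
      - 2 * ∑ a, ∑ b, (W (a, 1) (b, 1) * W (a, 0) (b, 0) - W (a, 1) (b, 0) * W (a, 0) (b, 1)) := by
  have h : ∀ a b k l, W (b, l) (a, k) = W (a, k) (b, l)
      - (if a = b then (!![0, 1; -1, 0] : Matrix (Fin 2) (Fin 2) ℝ) k l else 0) := fun a b k l => by
    have := congrFun (congrFun hW (a, k)) (b, l)
    simp only [Matrix.sub_apply, transpose_apply, sympMat, kronecker_apply, one_apply, ite_mul, one_mul,
      zero_mul] at this
    linarith
  have hcard : (Fintype.card ι : ℝ) = ∑ a : ι, ∑ b : ι, if a = b then 1 else 0 := by simp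
  rw [hcard, Finset.mul_sum, ← Finset.sum_sub_distrib]
  simp only [trace, diag, mul_apply (M := sympMat ι * W), Fintype.sum_prod_type,
    Fin.sum_univ_two, sympMat_mul_apply_zero, sympMat_mul_apply_one]
  refine Finset.sum_congr rfl fun a _ => ?_
  rw [Finset.mul_sum, ← Finset.sum_sub_distrib, ← Finset.sum_add_distrib]
  refine Finset.sum_congr rfl fun b _ => ?_
  rw [h a b 0 0, h a b 0 1, h a b 1 0, h a b 1 1]
  split_ifs with hab
  · subst hab
    simp
    linear_combination -sub_swap_of_sub_transpose_eq hW a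
  · simp
    ring

lemma det_smul_sub_transpose (hW : W - Wᵀ = sympMat ι) (t : ℝ) :
    (t • W - Wᵀ).det = (1 + (t - 1) • (-(sympMat ι * W))).det := by
  have : t • W - Wᵀ = sympMat ι * (1 + (t - 1) • (-(sympMat ι * W))) := by
    rw [mul_add, mul_one, mul_smul_comm, mul_neg, ← mul_assoc, sympMat_mul_self, ← hW]
    simp only [neg_mul, one_mul, neg_neg, sub_smul, one_smul]
    abel
  rw [this, det_mul, det_sympMat, one_mul]

end Symplectic

/-- If `V − Vᵀ = ω` (Seifert condition), then `½·Δ''(1) = λ'(V)` where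
`Δ(t) = t^{−g}·det(t·V − Vᵀ)`. -/
theorem half_alexFun_second_deriv_eq_lamPrime (g : ℕ) (hg : 1 ≤ g)
    (V : Matrix (Fin (2 * g)) (Fin (2 * g)) ℝ) (hV : V - Vᵀ = omegaMat g) :
    (1 / 2 : ℝ) * deriv (deriv (alexFun g V)) 1 = lamPrime g V := by
  rw [lamPrime_eq_sum]
  set W := V.submatrix (handleEquiv g) (handleEquiv g)
  have hW : W - Wᵀ = sympMat (Fin g) := by
    rw [← omegaMat_submatrix, ← hV]; rfl
  have hdet : ∀ t : ℝ, (t • V - Vᵀ).det = (t • W - Wᵀ).det := fun t => by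
    rw [← det_submatrix_equiv_self (handleEquiv g) (t • V - Vᵀ)]; rfl
  obtain ⟨Q, hQ, hQ0⟩ := exists_det_one_add_smul_eq (-(sympMat (Fin g) * W))
  rw [trace_neg, neg_mul_neg, trace_sympMat_mul hW, trace_sympMat_mul_sq hW] at hQ0
  simp only [trace_neg, trace_sympMat_mul hW] at hQ
  have hΔ : alexFun g V = fun t => t ^ (-(g : ℤ)) *
      (1 + C (g : ℝ) * (X - 1) + Q.comp (X - 1) * (X - 1) ^ 2 : ℝ[X]).eval t := by
    ext t
    rw [alexFun, hdet, det_smul_sub_transpose hW, hQ]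
    simp
  rw [hΔ, deriv_deriv_zpow_mul_eval]
  simp [derivative_comp, sq (X - 1 : ℝ[X])] at hQ0 ⊢
  linarith
end

section
/- Given combinatorial Heegaard diagram data as in the context, let m ⊆ C be a matching, i.e. a subset such that ι restricted to m is a bijection onto Fin g and κ restricted to m is a bijection onto Fin g, and assume σ takes the value 1 on every crossing of m or, more generally, define k : C → ℚ by k(c) := (1 if c ∈ m, else 0) − J_{κ(c), ι(c)} · σ(c). Then for every i₀ ∈ Fin g, Σ_{c : ι(c) = i₀} k(c) = 0, and for every j₀ ∈ Fin g, Σ_{c : κ(c) = j₀} k(c) = 0. (This is the paper's claim that the chain L(D, m) = Σ_{i} γ_i − Σ_{c} J_{j(c)i(c)} σ(c) γ(c) is a 1-cycle, expressed through its coefficient system.) -/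
open scoped BigOperators

/-- A set on which `f` is bijective meets each fibre of `f` in exactly one point. -/
theorem sum_fiber_indicator_eq_one {C α : Type*} [Fintype C] [DecidableEq C] [DecidableEq α]
    {f : C → α} {m : Finset C} (h : Set.BijOn f ↑m Set.univ) (a : α) :
    (∑ c ∈ Finset.univ.filter (fun c => f c = a), if c ∈ m then (1 : ℚ) else 0) = 1 := by
  obtain ⟨c, hc, rfl⟩ := h.surjOn (Set.mem_univ a)
  rw [Finset.sum_eq_single_of_mem c (by simp), if_pos (by simpa using hc)]
  intro d hd hdc
  refine if_neg fun hdm => hdc (h.injOn (by simpa using hdm) hc ?_)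
  simpa using hd

/-- Grouping a weighted sum by the values of the map that determines the weight. -/
theorem sum_comp_mul_eq_sum_mul_fiber {C α : Type*} [Fintype α] [DecidableEq α]
    (s : Finset C) (f : C → α) (w : α → ℚ) (σ : C → ℚ) :
    ∑ c ∈ s, w (f c) * σ c = ∑ a, w a * ∑ c ∈ s.filter (fun c => f c = a), σ c := by
  rw [← Finset.sum_fiberwise s f]
  refine Finset.sum_congr rfl fun a _ => ?_
  rw [Finset.mul_sum]
  refine Finset.sum_congr rfl fun c hc => ?_
  rw [(Finset.mem_filter.mp hc).2]

/-- Given combinatorial Heegaard diagram data and a matching `m` (a subset of the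
crossings on which both `ι` and `κ` restrict to bijections onto `Fin g`), the coefficient
system `k(c) = [c ∈ m] − J_{κ(c),ι(c)}·σ(c)` of the chain `L(D,m)` sums to zero over
each α-curve and over each β-curve, i.e. `L(D,m)` is a `1`-cycle. -/
theorem matching_cycle_property {C : Type*} [Fintype C] [DecidableEq C]
    (g : ℕ) (hg : 1 ≤ g) (ι κ : C → Fin g) (σ : C → ℚ)
    (J : Matrix (Fin g) (Fin g) ℚ)
    (hJ : ∀ j k : Fin g,
      (∑ i : Fin g, J j i *
        ∑ c ∈ Finset.univ.filter (fun c => ι c = i ∧ κ c = k), σ c)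
        = if j = k then 1 else 0)
    (m : Finset C)
    (hmι : Set.BijOn ι ↑m Set.univ)
    (hmκ : Set.BijOn κ ↑m Set.univ)
    (k : C → ℚ)
    (hk : ∀ c : C, k c = (if c ∈ m then 1 else 0) - J (κ c) (ι c) * σ c) :
    (∀ i₀ : Fin g, (∑ c ∈ Finset.univ.filter (fun c => ι c = i₀), k c) = 0) ∧
    (∀ j₀ : Fin g, (∑ c ∈ Finset.univ.filter (fun c => κ c = j₀), k c) = 0) := by
  let M : Matrix (Fin g) (Fin g) ℚ := fun i j =>
    ∑ c ∈ Finset.univ.filter (fun c => ι c = i ∧ κ c = j), σ c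
  have hJM : J * M = 1 := by
    ext j l
    rw [Matrix.mul_apply, Matrix.one_apply]
    exact hJ j l
  have hMJ : M * J = 1 := mul_eq_one_comm.mp hJM
  constructor
  · intro i₀
    have hsum : ∑ c ∈ Finset.univ.filter (fun c => ι c = i₀), J (κ c) (ι c) * σ c = 1 := by
      calc
        _ = ∑ c ∈ Finset.univ.filter (fun c => ι c = i₀), J (κ c) i₀ * σ c :=
          Finset.sum_congr rfl fun c hc => by rw [(Finset.mem_filter.mp hc).2]
        _ = ∑ j, J j i₀ * M i₀ j := by
          rw [sum_comp_mul_eq_sum_mul_fiber _ κ (fun j => J j i₀)]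
          simp only [Finset.filter_filter, M]
        _ = (M * J) i₀ i₀ := by
          simp only [Matrix.mul_apply, mul_comm]
        _ = 1 := by rw [hMJ, Matrix.one_apply_eq]
    simp only [hk, Finset.sum_sub_distrib, sum_fiber_indicator_eq_one hmι, hsum, sub_self]
  · intro j₀
    have hsum : ∑ c ∈ Finset.univ.filter (fun c => κ c = j₀), J (κ c) (ι c) * σ c = 1 := by
      calc
        _ = ∑ c ∈ Finset.univ.filter (fun c => κ c = j₀), J j₀ (ι c) * σ c :=
          Finset.sum_congr rfl fun c hc => by rw [(Finset.mem_filter.mp hc).2]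
        _ = ∑ i, J j₀ i * M i j₀ := by
          rw [sum_comp_mul_eq_sum_mul_fiber _ ι (J j₀)]
          simp only [Finset.filter_filter, M, and_comm]
        _ = 1 := by rw [← Matrix.mul_apply, hJM, Matrix.one_apply_eq]
    simp only [hk, Finset.sum_sub_distrib, sum_fiber_indicator_eq_one hmκ, hsum, sub_self]
end

section
/- Given combinatorial Heegaard diagram data as in the context, define G : C × C → ℚ by G(c,d) := J_{κ(c), ι(d)} · J_{κ(d), ι(c)} · σ(c) · σ(d) − (1 if c = d, else 0) · J_{κ(c), ι(c)} · σ(c). Then G satisfies all four cycle conditions: for every d ∈ C and every i₀ ∈ Fin g, Σ_{c : ι(c)=i₀} G(c,d) = 0; for every d ∈ C and every j₀ ∈ Fin g, Σ_{c : κ(c)=j₀} G(c,d) = 0; for every c ∈ C and every i₀ ∈ Fin g, Σ_{d : ι(d)=i₀} G(c,d) = 0; and for every c ∈ C and every j₀ ∈ Fin g, Σ_{d : κ(d)=j₀} G(c,d) = 0. (This is the combinatorial content of the paper's Proposition asserting that G(D) is a 2-cycle of M².) -/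
open scoped BigOperators

/-- Summing `f (p c) * σ c` over a fibre of `q` groups the terms according to the value of `p`. -/
theorem sum_fiber_mul {C I K : Type*} [Fintype C] [Fintype I] [DecidableEq I] [DecidableEq K]
    (p : C → I) (q : C → K) (σ : C → ℚ) (f : I → ℚ) (k : K) :
    ∑ c ∈ Finset.univ.filter (fun c => q c = k), f (p c) * σ c =
      ∑ i, f i * ∑ c ∈ Finset.univ.filter (fun c => p c = i ∧ q c = k), σ c := by
  rw [← Finset.sum_fiberwise _ p]
  refine Finset.sum_congr rfl fun i _ => ?_
  rw [Finset.mul_sum, Finset.filter_filter]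
  refine Finset.sum_congr (by ext; simp [and_comm]) fun c hc => ?_
  rw [(Finset.mem_filter.1 hc).2.1]

/-- Given combinatorial Heegaard diagram data, the coefficient system
`G(c,d) = J_{κ(c),ι(d)}·J_{κ(d),ι(c)}·σ(c)·σ(d) − δ_{cd}·J_{κ(c),ι(c)}·σ(c)` of the
`2`-chain `G(D)` satisfies all four cycle conditions (its sums over each α- or β-curve in
either variable vanish), i.e. `G(D)` is a `2`-cycle of `M²`. -/
theorem GD_is_two_cycle {C : Type*} [Fintype C] [DecidableEq C]
    (g : ℕ) (hg : 1 ≤ g) (ι κ : C → Fin g) (σ : C → ℚ)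
    (J : Matrix (Fin g) (Fin g) ℚ)
    (hJ : ∀ j k : Fin g,
      (∑ i : Fin g, J j i *
        ∑ c ∈ Finset.univ.filter (fun c => ι c = i ∧ κ c = k), σ c)
        = if j = k then 1 else 0)
    (G : C × C → ℚ)
    (hG : ∀ c d : C, G (c, d) =
      J (κ c) (ι d) * J (κ d) (ι c) * σ c * σ d -
        (if c = d then 1 else 0) * (J (κ c) (ι c) * σ c)) :
    (∀ d : C, ∀ i₀ : Fin g,
      (∑ c ∈ Finset.univ.filter (fun c => ι c = i₀), G (c, d)) = 0) ∧
    (∀ d : C, ∀ j₀ : Fin g,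
      (∑ c ∈ Finset.univ.filter (fun c => κ c = j₀), G (c, d)) = 0) ∧
    (∀ c : C, ∀ i₀ : Fin g,
      (∑ d ∈ Finset.univ.filter (fun d => ι d = i₀), G (c, d)) = 0) ∧
    (∀ c : C, ∀ j₀ : Fin g,
      (∑ d ∈ Finset.univ.filter (fun d => κ d = j₀), G (c, d)) = 0) := by
  have hβ (j k : Fin g) : ∑ c ∈ Finset.univ.filter (fun c => κ c = k), J j (ι c) * σ c =
      if j = k then 1 else 0 := by
    rw [sum_fiber_mul ι κ σ (J j) k, hJ]
  have hα (k i : Fin g) : ∑ c ∈ Finset.univ.filter (fun c => ι c = i), J (κ c) k * σ c =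
      if i = k then 1 else 0 := by
    let N : Matrix (Fin g) (Fin g) ℚ := fun i k =>
      ∑ c ∈ Finset.univ.filter (fun c => ι c = i ∧ κ c = k), σ c
    have hJN : J * N = 1 := by
      ext j k
      rw [Matrix.mul_apply, Matrix.one_apply]
      exact hJ j k
    have hNJ : (N * J) i k = (1 : Matrix (Fin g) (Fin g) ℚ) i k := by
      rw [mul_eq_one_comm.1 hJN]
    rw [Matrix.mul_apply, Matrix.one_apply] at hNJ
    rw [sum_fiber_mul κ ι σ (fun j => J j k) i, ← hNJ]
    refine Finset.sum_congr rfl fun j _ => ?_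
    simp only [N, and_comm, mul_comm]
  have hsymm (c d : C) : G (c, d) = G (d, c) := by
    rw [hG, hG]
    by_cases h : c = d
    · rw [h]
    · rw [if_neg h, if_neg (Ne.symm h)]
      ring
  have sum_alpha (d : C) (i₀ : Fin g) :
      ∑ c ∈ Finset.univ.filter (fun c => ι c = i₀), G (c, d) = 0 := by
    have h : ∀ c ∈ Finset.univ.filter (fun c => ι c = i₀), G (c, d) =
        J (κ d) i₀ * σ d * (J (κ c) (ι d) * σ c) -
          if c = d then J (κ d) (ι d) * σ d else 0 := by
      intro c hc
      rw [hG, ← (Finset.mem_filter.1 hc).2]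
      split_ifs with hcd
      · subst hcd; ring
      · ring
    rw [Finset.sum_congr rfl h, Finset.sum_sub_distrib, ← Finset.mul_sum, hα,
      Finset.sum_ite_eq']
    by_cases hd : ι d = i₀
    · simp [hd]
    · simp [hd, Ne.symm hd]
  have sum_beta (d : C) (j₀ : Fin g) :
      ∑ c ∈ Finset.univ.filter (fun c => κ c = j₀), G (c, d) = 0 := by
    have h : ∀ c ∈ Finset.univ.filter (fun c => κ c = j₀), G (c, d) =
        J j₀ (ι d) * σ d * (J (κ d) (ι c) * σ c) -
          if c = d then J (κ d) (ι d) * σ d else 0 := by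
      intro c hc
      rw [hG, ← (Finset.mem_filter.1 hc).2]
      split_ifs with hcd
      · subst hcd; ring
      · ring
    rw [Finset.sum_congr rfl h, Finset.sum_sub_distrib, ← Finset.mul_sum, hβ,
      Finset.sum_ite_eq']
    by_cases hd : κ d = j₀ <;> simp [hd]
  refine ⟨sum_alpha, sum_beta, fun c i₀ => ?_, fun c j₀ => ?_⟩
  · rw [Finset.sum_congr rfl fun d _ => hsymm c d]
    exact sum_alpha c i₀
  · rw [Finset.sum_congr rfl fun d _ => hsymm c d]
    exact sum_beta c j₀
end

section
/- Given combinatorial Heegaard diagram data with cyclic orders and the induced arc pairings and function ℓ as in the context, let G : C × C → ℚ satisfy the cycle conditions: for every d ∈ C and every i₀ ∈ Fin g, Σ_{c : ι(c)=i₀} G(c,d) = 0, and for every c ∈ C and every j₀ ∈ Fin g, Σ_{d : κ(d)=j₀} G(c,d) = 0. Then the quantity ℓ⁽²⁾(G) := Σ_{(c,d) ∈ C × C} G(c,d) · ℓ(c,d) does not depend on the choice of basepoints p and q used to define ℓ. (This is the basepoint-independence part of the paper's Proposition on ℓ⁽²⁾.) -/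
open scoped BigOperators

/-- Weight function of the half-open arc `[p,c|` on a cyclically ordered finite set
(the cyclic order being given by a bijection `e` with `ZMod (card S)`): when `p ≠ c`,
it assigns weight `1` to `p` and to every point strictly between `p` and `c` (travelling
from `p` in the positive cyclic direction), weight `1/2` to `c`, and `0` elsewhere;
when `p = c` it assigns weight `1/2` to `p` and `0` elsewhere. -/
def arcWeightHO {S : Type*} [Fintype S] [DecidableEq S]
    (e : S ≃ ZMod (Fintype.card S)) (p c x : S) : ℚ :=
  if p = c then (if x = p then 1 / 2 else 0)
  else if x = p then 1
  else if x = c then 1 / 2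
  else if 0 < (e x - e p).val ∧ (e x - e p).val < (e c - e p).val then 1
  else 0

/-- The function `ℓ(c,d)` of the paper, defined from combinatorial Heegaard diagram data
with cyclic orders, a matrix `J`, and basepoints `p(i)` on the α-curves and `q(j)` on the
β-curves:
`ℓ(c,d) = ⟨[p(ι c),c|_α, [q(κ d),d|_β⟩ − Σ_{i,j} J_{j,i}·⟨[p(ι c),c|_α, β_j⟩·⟨α_i, [q(κ d),d|_β⟩`. -/
noncomputable def ellFun {C : Type*} [Fintype C] [DecidableEq C] {g : ℕ}
    (ι κ : C → Fin g) (σ : C → ℚ) (J : Matrix (Fin g) (Fin g) ℚ)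
    (eA : ∀ i : Fin g, {c : C // ι c = i} ≃ ZMod (Fintype.card {c : C // ι c = i}))
    (eB : ∀ j : Fin g, {c : C // κ c = j} ≃ ZMod (Fintype.card {c : C // κ c = j}))
    (p : Fin g → C) (hp : ∀ i, ι (p i) = i)
    (q : Fin g → C) (hq : ∀ j, κ (q j) = j)
    (c d : C) : ℚ :=
  let wA : C → ℚ := fun x =>
    if hx : ι x = ι c then
      arcWeightHO (eA (ι c)) ⟨p (ι c), hp (ι c)⟩ ⟨c, rfl⟩ ⟨x, hx⟩
    else 0
  let wB : C → ℚ := fun x =>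
    if hx : κ x = κ d then
      arcWeightHO (eB (κ d)) ⟨q (κ d), hq (κ d)⟩ ⟨d, rfl⟩ ⟨x, hx⟩
    else 0
  (∑ x : C, wA x * wB x * σ x) -
    ∑ i : Fin g, ∑ j : Fin g, J j i *
      (∑ x ∈ Finset.univ.filter (fun x => κ x = j), wA x * σ x) *
      (∑ x ∈ Finset.univ.filter (fun x => ι x = i), wB x * σ x)

/-- The value of the weight function of `[p,c|` depends only on the comparison of the
distances from `p`. -/
lemma arcWeightHO_eq {S : Type*} [Fintype S] [DecidableEq S]
    (e : S ≃ ZMod (Fintype.card S)) (p c x : S) :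
    arcWeightHO e p c x =
      if (e x - e p).val < (e c - e p).val then 1
      else if (e x - e p).val = (e c - e p).val then 1 / 2 else 0 := by
  have : NeZero (Fintype.card S) := ⟨(Fintype.card_pos_iff.mpr ⟨p⟩).ne'⟩
  have hval (y z : S) : (e y - e p).val = (e z - e p).val ↔ y = z := by
    rw [(ZMod.val_injective _).eq_iff, sub_left_inj, e.injective.eq_iff]
  have hzero (y : S) : (e y - e p).val = 0 ↔ y = p := by
    rw [ZMod.val_eq_zero, sub_eq_zero, e.injective.eq_iff]
  have hxc := hval x c
  have hx := hzero x
  have hc := hzero c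
  unfold arcWeightHO
  grind

lemma ZMod.val_sub_eq_ite {n : ℕ} [NeZero n] (a b : ZMod n) :
    (a - b).val = if b.val ≤ a.val then a.val - b.val else a.val + n - b.val := by
  have ha := ZMod.val_lt a
  have hb := ZMod.val_lt b
  have hab := ZMod.val_lt (a - b)
  have h : a.val = ((a - b).val + b.val) % n := by rw [← ZMod.val_add, sub_add_cancel]
  rcases lt_or_ge ((a - b).val + b.val) n with hlt | hge
  · rw [Nat.mod_eq_of_lt hlt] at h
    split_ifs <;> omega
  · rw [Nat.mod_eq_sub_mod hge, Nat.mod_eq_of_lt (by omega)] at h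
    split_ifs <;> omega

/-- Changing the basepoint changes the weight function by a term independent of the endpoint
and a constant. -/
lemma arcWeightHO_change_basepoint {S : Type*} [Fintype S] [DecidableEq S]
    (e : S ≃ ZMod (Fintype.card S)) (p p' c x : S) :
    arcWeightHO e p c x = arcWeightHO e p' c x
      + (if (e x - e p).val < (e p' - e p).val then 1 else 0)
      - (if (e c - e p).val < (e p' - e p).val then 1 else 0) := by
  have : NeZero (Fintype.card S) := ⟨(Fintype.card_pos_iff.mpr ⟨p⟩).ne'⟩
  have hval (y : S) := ZMod.val_sub_eq_ite (e y - e p) (e p' - e p)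
  simp only [sub_sub_sub_cancel_right] at hval
  have hx := hval x
  have hc := hval c
  have hxlt := ZMod.val_lt (e x - e p)
  have hclt := ZMod.val_lt (e c - e p)
  have hplt := ZMod.val_lt (e p' - e p)
  rw [arcWeightHO_eq, arcWeightHO_eq]
  generalize (e x - e p).val = a at *
  generalize (e c - e p).val = b at *
  generalize (e p' - e p).val = k at *
  generalize (e x - e p').val = a' at *
  generalize (e c - e p').val = b' at *
  split_ifs at * <;> first | omega | norm_num

section Curves

variable {C : Type*} [Fintype C] {g : ℕ}

/-- The weight function on all crossings of the arc `[p(ι c),c|`. -/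
def curveWeight [DecidableEq C] (ι : C → Fin g)
    (e : ∀ i : Fin g, {c : C // ι c = i} ≃ ZMod (Fintype.card {c : C // ι c = i}))
    (p : Fin g → C) (hp : ∀ i, ι (p i) = i) (c x : C) : ℚ :=
  if hx : ι x = ι c then
    arcWeightHO (e (ι c)) ⟨p (ι c), hp (ι c)⟩ ⟨c, rfl⟩ ⟨x, hx⟩
  else 0

lemma exists_curveWeight_change_basepoint [DecidableEq C] (ι : C → Fin g)
    (e : ∀ i : Fin g, {c : C // ι c = i} ≃ ZMod (Fintype.card {c : C // ι c = i}))
    (p p' : Fin g → C) (hp : ∀ i, ι (p i) = i) (hp' : ∀ i, ι (p' i) = i) :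
    ∃ (u : Fin g → C → ℚ) (s : C → ℚ), ∀ c, curveWeight ι e p hp c =
      curveWeight ι e p' hp' c + u (ι c) + s c • fun x => if ι x = ι c then 1 else 0 := by
  refine ⟨fun i x => if hx : ι x = i then
      (if (e i ⟨x, hx⟩ - e i ⟨p i, hp i⟩).val < (e i ⟨p' i, hp' i⟩ - e i ⟨p i, hp i⟩).val
        then 1 else 0) else 0,
    fun c => -(if (e (ι c) ⟨c, rfl⟩ - e (ι c) ⟨p (ι c), hp _⟩).val <
      (e (ι c) ⟨p' (ι c), hp' _⟩ - e (ι c) ⟨p (ι c), hp _⟩).val then 1 else 0),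
    fun c => funext fun x => ?_⟩
  simp only [curveWeight, Pi.add_apply, Pi.smul_apply, smul_eq_mul]
  by_cases hx : ι x = ι c
  · simp only [hx, dite_true, if_true, mul_one]
    rw [arcWeightHO_change_basepoint _ _ ⟨p' (ι c), hp' _⟩, sub_eq_add_neg]
  · simp [hx]

/-- The pairing `⟨w,v⟩ − Σ_{i,j} J_{j,i}·⟨w,β_j⟩·⟨α_i,v⟩` of weight functions. -/
def reducedPairing (ι κ : C → Fin g) (σ : C → ℚ) (J : Matrix (Fin g) (Fin g) ℚ)
    (w v : C → ℚ) : ℚ :=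
  (∑ x, w x * v x * σ x) -
    ∑ i : Fin g, ∑ j : Fin g, J j i *
      (∑ x ∈ Finset.univ.filter (fun x => κ x = j), w x * σ x) *
      (∑ x ∈ Finset.univ.filter (fun x => ι x = i), v x * σ x)

variable (ι κ : C → Fin g) (σ : C → ℚ) (J : Matrix (Fin g) (Fin g) ℚ)

lemma ellFun_eq_reducedPairing [DecidableEq C]
    (eA : ∀ i : Fin g, {c : C // ι c = i} ≃ ZMod (Fintype.card {c : C // ι c = i}))
    (eB : ∀ j : Fin g, {c : C // κ c = j} ≃ ZMod (Fintype.card {c : C // κ c = j}))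
    (p : Fin g → C) (hp : ∀ i, ι (p i) = i) (q : Fin g → C) (hq : ∀ j, κ (q j) = j) (c d : C) :
    ellFun ι κ σ J eA eB p hp q hq c d =
      reducedPairing ι κ σ J (curveWeight ι eA p hp c) (curveWeight κ eB q hq d) := rfl

lemma reducedPairing_swap (w v : C → ℚ) :
    reducedPairing ι κ σ J w v = reducedPairing κ ι σ J.transpose v w := by
  unfold reducedPairing
  rw [Finset.sum_comm (f := fun i j => J j i * _ * _)]
  simp only [Matrix.transpose_apply, mul_right_comm (J _ _), mul_comm (w _) (v _)]

lemma reducedPairing_add_left (w w' v : C → ℚ) :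
    reducedPairing ι κ σ J (w + w') v =
      reducedPairing ι κ σ J w v + reducedPairing ι κ σ J w' v := by
  simp only [reducedPairing, Pi.add_apply, add_mul, mul_add, Finset.sum_add_distrib]
  ring

lemma reducedPairing_smul_left (s : ℚ) (w v : C → ℚ) :
    reducedPairing ι κ σ J (s • w) v = s * reducedPairing ι κ σ J w v := by
  simp only [reducedPairing, Pi.smul_apply, smul_eq_mul, mul_assoc, ← Finset.mul_sum,
    mul_left_comm _ s, ← mul_sub]

/-- The reduced pairing vanishes on full α-curves. -/
lemma reducedPairing_curve_left
    (hJ : ∀ i k : Fin g, (∑ j : Fin g, J j i *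
        ∑ c ∈ Finset.univ.filter (fun c => κ c = j ∧ ι c = k), σ c) = if i = k then 1 else 0)
    (k : Fin g) (v : C → ℚ) :
    reducedPairing ι κ σ J (fun x => if ι x = k then 1 else 0) v = 0 := by
  have h (j : Fin g) : (∑ x ∈ Finset.univ.filter (fun x => κ x = j),
      (if ι x = k then 1 else 0) * σ x) =
      ∑ c ∈ Finset.univ.filter (fun c => κ c = j ∧ ι c = k), σ c := by
    simp [← Finset.filter_filter, Finset.sum_filter]
  simp only [reducedPairing, h, ← Finset.sum_mul, hJ]
  simp [Finset.sum_filter]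

/-- The sum of a family of reduced pairings against coefficients that sum to zero over each
α-curve does not depend on the basepoints on the α-curves. -/
lemma sum_reducedPairing_change_basepoint [DecidableEq C]
    (hJ : ∀ i k : Fin g, (∑ j : Fin g, J j i *
        ∑ c ∈ Finset.univ.filter (fun c => κ c = j ∧ ι c = k), σ c) = if i = k then 1 else 0)
    (e : ∀ i : Fin g, {c : C // ι c = i} ≃ ZMod (Fintype.card {c : C // ι c = i}))
    (p p' : Fin g → C) (hp : ∀ i, ι (p i) = i) (hp' : ∀ i, ι (p' i) = i)
    (γ : C → ℚ) (hγ : ∀ i, (∑ c ∈ Finset.univ.filter (fun c => ι c = i), γ c) = 0)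
    (v : C → ℚ) :
    ∑ c, γ c * reducedPairing ι κ σ J (curveWeight ι e p hp c) v =
      ∑ c, γ c * reducedPairing ι κ σ J (curveWeight ι e p' hp' c) v := by
  obtain ⟨u, s, h⟩ := exists_curveWeight_change_basepoint ι e p p' hp hp'
  simp only [h, reducedPairing_add_left, reducedPairing_smul_left,
    reducedPairing_curve_left ι κ σ J hJ, mul_zero, add_zero, mul_add, Finset.sum_add_distrib]
  rw [add_eq_left, ← Finset.sum_fiberwise (s := Finset.univ) (g := ι)]
  refine Finset.sum_eq_zero fun i _ => ?_
  rw [Finset.sum_congr rfl (g := fun c => γ c * reducedPairing ι κ σ J (u i) v)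
    fun c hc => by rw [(Finset.mem_filter.mp hc).2], ← Finset.sum_mul, hγ, zero_mul]

end Curves

/-- If `G` satisfies the two cycle conditions (its sums over each α-curve in the first
variable and over each β-curve in the second variable vanish), then the quantity
`ℓ⁽²⁾(G) = Σ_{(c,d)} G(c,d)·ℓ(c,d)` does not depend on the choice of the basepoints
used to define `ℓ`. -/
theorem ell_two_independent_of_basepoints {C : Type*} [Fintype C] [DecidableEq C]
    (g : ℕ) (hg : 1 ≤ g) (ι κ : C → Fin g) (σ : C → ℚ)
    (J : Matrix (Fin g) (Fin g) ℚ)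
    (hJ : ∀ j k : Fin g,
      (∑ i : Fin g, J j i *
        ∑ c ∈ Finset.univ.filter (fun c => ι c = i ∧ κ c = k), σ c)
        = if j = k then 1 else 0)
    (eA : ∀ i : Fin g, {c : C // ι c = i} ≃ ZMod (Fintype.card {c : C // ι c = i}))
    (eB : ∀ j : Fin g, {c : C // κ c = j} ≃ ZMod (Fintype.card {c : C // κ c = j}))
    (G : C × C → ℚ)
    (hG1 : ∀ d : C, ∀ i₀ : Fin g,
      (∑ c ∈ Finset.univ.filter (fun c => ι c = i₀), G (c, d)) = 0)
    (hG2 : ∀ c : C, ∀ j₀ : Fin g,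
      (∑ d ∈ Finset.univ.filter (fun d => κ d = j₀), G (c, d)) = 0)
    (p p' : Fin g → C) (hp : ∀ i, ι (p i) = i) (hp' : ∀ i, ι (p' i) = i)
    (q q' : Fin g → C) (hq : ∀ j, κ (q j) = j) (hq' : ∀ j, κ (q' j) = j) :
    ∑ cd : C × C, G cd * ellFun ι κ σ J eA eB p hp q hq cd.1 cd.2
      = ∑ cd : C × C, G cd * ellFun ι κ σ J eA eB p' hp' q' hq' cd.1 cd.2 := by
  have hJ' (i k : Fin g) : (∑ j : Fin g, J j i *
      ∑ c ∈ Finset.univ.filter (fun c => κ c = j ∧ ι c = k), σ c) = if i = k then 1 else 0 := by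
    let M : Matrix (Fin g) (Fin g) ℚ := Matrix.of fun i k =>
      ∑ c ∈ Finset.univ.filter (fun c => ι c = i ∧ κ c = k), σ c
    have hJM : J * M = 1 := by
      ext j k
      simpa [Matrix.mul_apply, Matrix.one_apply, M] using hJ j k
    have hMJ' : M * J = 1 := mul_eq_one_comm.mp hJM
    have hMJ := congrFun₂ hMJ' k i
    simpa only [Matrix.mul_apply, Matrix.one_apply, M, Matrix.of_apply, and_comm, mul_comm,
      eq_comm] using hMJ
  simp only [Fintype.sum_prod_type, ellFun_eq_reducedPairing]
  trans ∑ c, ∑ d, G (c, d) *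
    reducedPairing ι κ σ J (curveWeight ι eA p' hp' c) (curveWeight κ eB q hq d)
  · rw [Finset.sum_comm]
    conv_rhs => rw [Finset.sum_comm]
    exact Finset.sum_congr rfl fun d _ =>
      sum_reducedPairing_change_basepoint ι κ σ J hJ' eA p p' hp hp' _ (hG1 d) _
  · simp only [reducedPairing_swap ι κ]
    exact Finset.sum_congr rfl fun c _ =>
      sum_reducedPairing_change_basepoint κ ι σ J.transpose hJ eB q q' hq hq' _ (hG2 c) _
end
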